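/- For every integer n ≥ 1, the sum of 1/α(T) over all rooted trees T with exactly n vertices equals n^{n−1}/n! in ℚ. -/

import Mathlib

namespace ZhaoForest

inductive PreTree : Type
  | node : List PreTree → PreTree

namespace PreTree

def children : PreTree → List PreTree
  | node l => l

inductive Equiv : PreTree → PreTree → Prop
  | refl (t) : Equiv t t
  | symm {a b} : Equiv a b → Equiv b a
  | trans {a b c} : Equiv a b → Equiv b c → Equiv a c
  | perm {l l'} : l.Perm l' → Equiv (node l) (node l')
  | congr {a b} (l₁ l₂ : List PreTree) : Equiv a b →
      Equiv (node (l₁ ++ a :: l₂)) (node (l₁ ++ b :: l₂))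

instance setoid : Setoid PreTree := ⟨Equiv, ⟨Equiv.refl, Equiv.symm, Equiv.trans⟩⟩

/-- number of vertices -/
def size : PreTree → ℕ
  | node l => 1 + (l.attach.map fun x => size x.1).sum
decreasing_by
  have h := List.sizeOf_lt_of_mem x.2
  simp only [PreTree.node.sizeOf_spec]
  omega

end PreTree

/-- Isomorphism classes of rooted trees. -/
def RootedTree := Quotient PreTree.setoid

namespace RootedTree

/-- vertex count -/
noncomputable def v (T : RootedTree) : ℕ := T.out.size

/-- `B₊`: join the members of a forest to a new root. -/
noncomputable def node (m : Multiset RootedTree) : RootedTree :=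
  ⟦PreTree.node ((m.map Quotient.out).toList)⟧

end RootedTree

open Classical in
/-- symmetry factor `α` on representatives -/
noncomputable def PreTree.alphaAux : PreTree → ℕ
  | .node l =>
    let m : Multiset RootedTree :=
      Multiset.ofList (α := RootedTree) (l.map fun t => (⟦t⟧ : RootedTree))
    (∏ U ∈ m.toFinset, (m.count U).factorial) *
    (l.attach.map fun x => PreTree.alphaAux x.1).prod
decreasing_by
  have h := List.sizeOf_lt_of_mem x.2
  simp only [PreTree.node.sizeOf_spec]
  omega

/-- The order of the automorphism group of a rooted tree. -/
noncomputable def RootedTree.alpha (T : RootedTree) : ℕ := PreTree.alphaAux T.out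

section Psi

variable {k A : Type} [Field k] [CommRing A] [Algebra k A]

/-- the invariant `Ψ` on representatives -/
noncomputable def PreTree.psiAux (Ξ : A →ₗ[k] A) : PreTree → A
  | .node l => Ξ (l.attach.map fun x => PreTree.psiAux Ξ x.1).prod
decreasing_by
  have h := List.sizeOf_lt_of_mem x.2
  simp only [PreTree.node.sizeOf_spec]
  omega

/-- The invariant `Ψ` of rooted trees associated to `Ξ`. -/
noncomputable def RootedTree.psi (Ξ : A →ₗ[k] A) (T : RootedTree) : A :=
  PreTree.psiAux Ξ T.out

/-- The invariant `Ψ` of rooted forests. -/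
noncomputable def psiForest (Ξ : A →ₗ[k] A) (F : Multiset RootedTree) : A :=
  (F.map (RootedTree.psi Ξ)).prod

end Psi

/-- The isomorphism class of a planar representative. -/
def RootedTree.mk (t : PreTree) : RootedTree := Quotient.mk PreTree.setoid t

/-- A planar representative of an isomorphism class. -/
noncomputable def RootedTree.rep (T : RootedTree) : PreTree := Quotient.out T

theorem RootedTree.mk_eq_mk {a b : PreTree} (h : PreTree.Equiv a b) : mk a = mk b :=
  Quotient.sound h

theorem RootedTree.rep_mk (t : PreTree) : PreTree.Equiv (mk t).rep t :=
  Quotient.mk_out t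

theorem RootedTree.mk_rep (T : RootedTree) : mk T.rep = T :=
  Quotient.out_eq T

namespace PreTree

theorem size_node (l : List PreTree) : (node l).size = 1 + (l.map size).sum := by
  conv_rhs => rw [← l.attach_map_subtype_val, List.map_map]
  rw [size]
  rfl

open Classical in
theorem alphaAux_node (l : List PreTree) :
    (node l).alphaAux =
      (∏ U ∈ (Multiset.ofList (l.map RootedTree.mk)).toFinset,
        ((Multiset.ofList (l.map RootedTree.mk)).count U).factorial) *
      (l.map alphaAux).prod := by
  have h : l.attach.map (fun x => x.1.alphaAux) = l.map alphaAux := by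
    conv_rhs => rw [← l.attach_map_subtype_val, List.map_map]
    rfl
  rw [alphaAux, h]
  rfl

theorem Equiv.size_eq {a b : PreTree} (h : Equiv a b) : a.size = b.size := by
  induction h with
  | refl => rfl
  | symm _ ih => exact ih.symm
  | trans _ _ ih₁ ih₂ => exact ih₁.trans ih₂
  | perm h => rw [size_node, size_node, (h.map size).sum_eq]
  | congr l₁ l₂ _ ih => simp [size_node, ih]

/-- The multiset of isomorphism classes of the subtrees at the root. -/
def childClasses (t : PreTree) : Multiset RootedTree :=
  Multiset.ofList (t.children.map RootedTree.mk)

theorem Equiv.childClasses_eq {a b : PreTree} (h : Equiv a b) :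
    a.childClasses = b.childClasses := by
  induction h with
  | refl => rfl
  | symm _ ih => exact ih.symm
  | trans _ _ ih₁ ih₂ => exact ih₁.trans ih₂
  | perm h => exact Multiset.coe_eq_coe.2 (h.map _)
  | @congr a b l₁ l₂ h _ =>
    simp only [childClasses, children, List.map_append, List.map_cons, RootedTree.mk_eq_mk h]

theorem Equiv.alphaAux_eq {a b : PreTree} (h : Equiv a b) : a.alphaAux = b.alphaAux := by
  induction h with
  | refl => rfl
  | symm _ ih => exact ih.symm
  | trans _ _ ih₁ ih₂ => exact ih₁.trans ih₂
  | @perm l l' h =>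
    have h' := (Equiv.perm h).childClasses_eq
    simp only [childClasses, children] at h'
    rw [alphaAux_node, alphaAux_node, h', (h.map alphaAux).prod_eq]
  | @congr a b l₁ l₂ h ih =>
    have h' := (Equiv.congr l₁ l₂ h).childClasses_eq
    simp only [childClasses, children] at h'
    rw [alphaAux_node, alphaAux_node, h']
    simp [ih]

theorem Equiv.node_of_forall₂ {l l' : List PreTree} (h : List.Forall₂ Equiv l l') :
    ∀ p : List PreTree, Equiv (node (p ++ l)) (node (p ++ l')) := by
  induction h with
  | nil => exact fun _ => .refl _
  | @cons a b l l' h _ ih =>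
    intro p
    refine (Equiv.congr p l h).trans ?_
    simpa using ih (p ++ [b])

end PreTree

namespace RootedTree

theorem v_mk (t : PreTree) : (mk t).v = t.size :=
  (rep_mk t).size_eq

theorem alpha_mk (t : PreTree) : (mk t).alpha = t.alphaAux :=
  (rep_mk t).alphaAux_eq

theorem node_eq_mk (m : Multiset RootedTree) : node m = mk (.node (m.map rep).toList) :=
  rfl

/-- The multiset of subtrees at the root. -/
def children : RootedTree → Multiset RootedTree :=
  Quotient.lift PreTree.childClasses fun _ _ h => PreTree.Equiv.childClasses_eq h

theorem coe_map_mk_toList (m : Multiset RootedTree) :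
    Multiset.ofList ((m.map rep).toList.map mk) = m := by
  rw [← Multiset.map_coe, Multiset.coe_toList, Multiset.map_map]
  simp [mk_rep]

@[simp]
theorem children_node (m : Multiset RootedTree) : (node m).children = m :=
  coe_map_mk_toList m

theorem mk_surjective : Function.Surjective mk := fun T => ⟨T.rep, T.mk_rep⟩

@[simp]
theorem node_children (T : RootedTree) : node T.children = T := by
  obtain ⟨⟨l⟩, rfl⟩ := mk_surjective T
  rw [node_eq_mk]
  refine mk_eq_mk ?_
  have hp : (((mk (.node l)).children.map rep).toList).Perm (l.map fun t => (mk t).rep) := by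
    rw [← Multiset.coe_eq_coe, Multiset.coe_toList]
    change Multiset.map rep (Multiset.ofList (l.map mk)) = _
    simp [Function.comp_def]
  refine (PreTree.Equiv.perm hp).trans (PreTree.Equiv.node_of_forall₂ ?_ [])
  rw [List.forall₂_map_left_iff, List.forall₂_same]
  exact fun t _ => rep_mk t

theorem v_node (m : Multiset RootedTree) : (node m).v = 1 + (m.map v).sum := by
  rw [node_eq_mk, v_mk, PreTree.size_node, ← Multiset.sum_coe, ← Multiset.map_coe,
    Multiset.coe_toList, Multiset.map_map]
  rfl

open Classical in
theorem alpha_node (m : Multiset RootedTree) :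
    (node m).alpha = (∏ U ∈ m.toFinset, (m.count U).factorial) * (m.map alpha).prod := by
  rw [node_eq_mk, alpha_mk, PreTree.alphaAux_node, coe_map_mk_toList, ← Multiset.prod_coe,
    ← Multiset.map_coe, Multiset.coe_toList, Multiset.map_map]
  rfl

theorem v_pos (T : RootedTree) : 0 < T.v := by
  rw [← node_children T, v_node]
  omega

theorem v_children (T : RootedTree) : (T.children.map v).sum = T.v - 1 := by
  conv_rhs => rw [← node_children T, v_node]
  omega

theorem v_node_cons (U : RootedTree) (m : Multiset RootedTree) :
    (node (U ::ₘ m)).v = U.v + (node m).v := by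
  simp only [v_node, Multiset.map_cons, Multiset.sum_cons]
  omega

open Classical in
theorem alpha_node_cons (U : RootedTree) (m : Multiset RootedTree) :
    (node (U ::ₘ m)).alpha = (U ::ₘ m).count U * U.alpha * (node m).alpha := by
  have key : ∏ W ∈ (U ::ₘ m).toFinset, ((U ::ₘ m).count W).factorial =
      (U ::ₘ m).count U * ∏ W ∈ m.toFinset, (m.count W).factorial := by
    have h : ∏ W ∈ m.toFinset, (m.count W).factorial =
        ∏ W ∈ (U ::ₘ m).toFinset, (m.count W).factorial := by
      refine Finset.prod_subset (fun W hW => ?_) fun W _ hW => ?_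
      · simp only [Multiset.mem_toFinset] at hW ⊢
        exact Multiset.mem_cons_of_mem hW
      · rw [Multiset.mem_toFinset] at hW
        rw [Multiset.count_eq_zero_of_notMem hW, Nat.factorial_zero]
    have hU : U ∈ (U ::ₘ m).toFinset := by simp
    rw [h, ← Finset.mul_prod_erase _ _ hU, ← Finset.mul_prod_erase _ _ hU,
      Multiset.count_cons_self, Nat.factorial_succ, mul_assoc]
    congr 2
    refine Finset.prod_congr rfl fun W hW => ?_
    rw [Multiset.count_cons_of_ne (Finset.ne_of_mem_erase hW)]
  rw [alpha_node, alpha_node, key, Multiset.map_cons, Multiset.prod_cons]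
  ring

theorem card_le_sum_v (m : Multiset RootedTree) : m.card ≤ (m.map v).sum := by
  simpa using Multiset.card_nsmul_le_sum (s := m.map v) (a := 1) (by
    simp only [Multiset.mem_map, forall_exists_index, and_imp, forall_apply_eq_imp_iff₂]
    exact fun U _ => U.v_pos)

theorem finite_setOf_v_le (n : ℕ) : {T : RootedTree | T.v ≤ n}.Finite := by
  classical
  induction n with
  | zero =>
    refine Set.finite_empty.subset fun T hT => ?_
    exact absurd hT (not_le.2 T.v_pos)
  | succ n ih =>
    refine ((n • ih.toFinset.val).powerset.toFinset.finite_toSet.image node).subset ?_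
    intro T hT
    refine ⟨T.children, ?_, node_children T⟩
    have hv := T.v_children
    simp only [Set.mem_ofPred_eq] at hT
    simp only [Finset.mem_coe, Multiset.mem_toFinset, Multiset.mem_powerset]
    rw [Multiset.le_iff_count]
    intro U
    by_cases hU : U ∈ T.children
    · have hUv : U.v ≤ n := by
        have := Multiset.le_sum_of_mem (Multiset.mem_map_of_mem v hU)
        omega
      have hmem : U ∈ ih.toFinset := by simpa using hUv
      rw [Multiset.count_nsmul, Multiset.count_eq_one_of_mem ih.toFinset.nodup hmem, mul_one]
      have := card_le_sum_v T.children
      have := Multiset.count_le_card U T.children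
      omega
    · rw [Multiset.count_eq_zero_of_notMem hU]
      exact Nat.zero_le _

theorem finite_setOf_v_eq (n : ℕ) : {T : RootedTree | T.v = n}.Finite :=
  (finite_setOf_v_le n).subset fun _ h => le_of_eq h

/-- The finite set of rooted trees with `n` vertices. -/
noncomputable def ofSize (n : ℕ) : Finset RootedTree := (finite_setOf_v_eq n).toFinset

@[simp]
theorem mem_ofSize {n : ℕ} {T : RootedTree} : T ∈ ofSize n ↔ T.v = n := by
  simp [ofSize]

/-- The total weight `∑ 1 / α(T)` of the rooted trees with `n` vertices. -/
noncomputable def weight (n : ℕ) : ℚ := ∑ T ∈ ofSize n, (T.alpha : ℚ)⁻¹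

theorem weight_zero : weight 0 = 0 :=
  Finset.sum_eq_zero fun T hT => absurd (mem_ofSize.1 hT) T.v_pos.ne'

theorem weight_one : weight 1 = 1 := by
  have h : ofSize 1 = {node 0} := by
    ext T
    rw [mem_ofSize, Finset.mem_singleton]
    constructor
    · intro hT
      have hc : T.children = 0 := by
        have := card_le_sum_v T.children
        rw [v_children, hT] at this
        exact Multiset.card_eq_zero.1 (by omega)
      rw [← node_children T, hc]
    · rintro rfl
      simp [v_node]
  simp [weight, h, alpha_node]

/-- Marking a branch at the root of a tree cuts the tree into two. -/
theorem weight_recurrence (n : ℕ) :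
    ((n : ℚ) - 1) * weight n =
      ∑ p ∈ Finset.HasAntidiagonal.antidiagonal n, (p.1 : ℚ) * weight p.1 * weight p.2 := by
  classical
  have hL : ((n : ℚ) - 1) * weight n = ∑ x ∈ (ofSize n).sigma fun T => T.children.toFinset,
      (x.1.children.count x.2 : ℚ) * x.2.v * (x.1.alpha : ℚ)⁻¹ := by
    rw [Finset.sum_sigma, weight, Finset.mul_sum]
    refine Finset.sum_congr rfl fun T hT => ?_
    dsimp only
    rw [← Finset.sum_mul]
    congr 1
    have h1 := T.v_children
    rw [Finset.sum_multiset_map_count] at h1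
    have h2 : 1 ≤ n := mem_ofSize.1 hT ▸ T.v_pos
    rw [mem_ofSize.1 hT] at h1
    have h3 := congrArg (Nat.cast (R := ℚ)) h1
    rw [Nat.cast_sub h2] at h3
    simpa using h3.symm
  have hR : ∑ p ∈ Finset.HasAntidiagonal.antidiagonal n, (p.1 : ℚ) * weight p.1 * weight p.2 =
      ∑ x ∈ (Finset.HasAntidiagonal.antidiagonal n).sigma fun p => ofSize p.1 ×ˢ ofSize p.2,
        (x.2.1.v : ℚ) * (x.2.1.alpha : ℚ)⁻¹ * (x.2.2.alpha : ℚ)⁻¹ := by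
    rw [Finset.sum_sigma]
    refine Finset.sum_congr rfl fun p _ => ?_
    rw [Finset.sum_product, weight, weight, mul_assoc, Finset.sum_mul_sum, Finset.mul_sum]
    refine Finset.sum_congr rfl fun U hU => ?_
    rw [Finset.mul_sum]
    refine Finset.sum_congr rfl fun T _ => ?_
    rw [mem_ofSize.1 hU, mul_assoc]
  rw [hL, hR]
  refine Finset.sum_bij'
    (fun x _ => ⟨(x.2.v, (node (x.1.children.erase x.2)).v),
      (x.2, node (x.1.children.erase x.2))⟩)
    (fun y _ => ⟨node (y.2.1 ::ₘ y.2.2.children), y.2.1⟩) ?_ ?_ ?_ ?_ ?_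
  · rintro ⟨T, U⟩ h
    simp only [Finset.mem_sigma, mem_ofSize, Multiset.mem_toFinset] at h
    simp only [Finset.mem_sigma, Finset.HasAntidiagonal.mem_antidiagonal, Finset.mem_product, mem_ofSize,
      and_true]
    rw [← v_node_cons, Multiset.cons_erase h.2, node_children, h.1]
  · rintro ⟨⟨a, b⟩, U, T⟩ h
    simp only [Finset.mem_sigma, Finset.HasAntidiagonal.mem_antidiagonal, Finset.mem_product, mem_ofSize] at h
    simp [v_node_cons, h]
  · rintro ⟨T, U⟩ h
    simp only [Finset.mem_sigma, mem_ofSize, Multiset.mem_toFinset] at h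
    simp [Multiset.cons_erase h.2]
  · rintro ⟨⟨a, b⟩, U, T⟩ h
    simp only [Finset.mem_sigma, Finset.HasAntidiagonal.mem_antidiagonal, Finset.mem_product, mem_ofSize] at h
    obtain ⟨-, rfl, rfl⟩ := h
    simp
  · rintro ⟨T, U⟩ h
    simp only [Finset.mem_sigma, mem_ofSize, Multiset.mem_toFinset] at h
    have ha := alpha_node_cons U (T.children.erase U)
    rw [Multiset.cons_erase h.2, node_children] at ha
    have hc : (T.children.count U : ℚ) ≠ 0 := by
      exact_mod_cast (Multiset.count_pos.2 h.2).ne'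
    simp only [ha]
    push_cast
    field_simp

end RootedTree

/-- The exponential coefficients `n ^ (n - 1) / n!` of the tree function. -/
def treeCoeff (n : ℕ) : ℚ := if n = 0 then 0 else (n : ℚ) ^ (n - 1) / n.factorial

theorem mul_treeCoeff {n : ℕ} (hn : n ≠ 0) :
    (n : ℚ) * treeCoeff n = (n : ℚ) ^ n / n.factorial := by
  rw [treeCoeff, if_neg hn, mul_div_assoc', ← pow_succ', Nat.sub_add_cancel (by omega)]

theorem cast_add_choose_mul_factorial_mul_factorial (i j : ℕ) :
    ((i + j).choose i : ℚ) * i.factorial * j.factorial = (i + j).factorial := by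
  rw [Nat.choose_symm_add]
  exact_mod_cast Nat.add_choose_mul_factorial_mul_factorial i j

theorem add_pow_div_factorial (x y : ℚ) (n : ℕ) :
    (x + y) ^ n / n.factorial =
      ∑ p ∈ Finset.HasAntidiagonal.antidiagonal n, x ^ p.1 / p.1.factorial * (y ^ p.2 / p.2.factorial) := by
  rw [(Commute.all x y).add_pow', Finset.sum_div]
  refine Finset.sum_congr rfl fun p hp => ?_
  obtain ⟨i, j⟩ := p
  obtain rfl := Finset.HasAntidiagonal.mem_antidiagonal.1 hp
  have h := cast_add_choose_mul_factorial_mul_factorial i j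
  have hi : (i.factorial : ℚ) ≠ 0 := by exact_mod_cast i.factorial_ne_zero
  have hj : (j.factorial : ℚ) ≠ 0 := by exact_mod_cast j.factorial_ne_zero
  have hij : ((i + j).factorial : ℚ) ≠ 0 := by exact_mod_cast (i + j).factorial_ne_zero
  simp only [nsmul_eq_mul]
  field_simp
  rw [← h]
  ring

theorem sum_treeCoeff_mul_neg_pow (m : ℕ) :
    ∑ p ∈ Finset.HasAntidiagonal.antidiagonal m, treeCoeff p.1 * ((-(p.1 : ℚ)) ^ p.2 / p.2.factorial) =
      if m = 1 then 1 else 0 := by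
  rcases m with _ | _ | m
  · simp [treeCoeff]
  · simp [Finset.Nat.antidiagonal_succ, treeCoeff]
  rw [if_neg (by omega)]
  have hd := congrFun (fwdDiff_iter_pow_eq_zero_of_lt (R := ℚ) (Nat.lt_add_one (m + 1))) 0
  rw [fwdDiff_iter_eq_sum_shift] at hd
  have hf : ((m + 1 + 1).factorial : ℚ) ≠ 0 := by exact_mod_cast (m + 1 + 1).factorial_ne_zero
  refine (mul_eq_zero.1 ?_).resolve_left hf
  rw [Finset.mul_sum, Finset.Nat.sum_antidiagonal_eq_sum_range_succ_mk]
  refine Eq.trans (Finset.sum_congr rfl fun k hk => ?_) hd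
  obtain ⟨l, hl⟩ := Nat.exists_eq_add_of_le (Nat.lt_succ_iff.1 (Finset.mem_range.1 hk))
  rcases k with _ | k
  · simp [treeCoeff]
  have h := cast_add_choose_mul_factorial_mul_factorial (k + 1) l
  have h1 : m + 1 + 1 - (k + 1) = l := by omega
  have h2 : m + 1 = k + l := by omega
  have hi : ((k + 1).factorial : ℚ) ≠ 0 := by exact_mod_cast (k + 1).factorial_ne_zero
  have hj : (l.factorial : ℚ) ≠ 0 := by exact_mod_cast l.factorial_ne_zero
  rw [h1, h2, show k + l + 1 = k + 1 + l by omega, ← h, treeCoeff, if_neg (by omega), neg_pow]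
  simp only [Nat.add_sub_cancel, zsmul_eq_mul, nsmul_eq_mul]
  push_cast
  field_simp
  ring

theorem sum_antidiagonal_assoc (f : ℕ → ℕ → ℕ → ℚ) (n : ℕ) :
    ∑ p ∈ Finset.HasAntidiagonal.antidiagonal n, ∑ q ∈ Finset.HasAntidiagonal.antidiagonal p.2, f p.1 q.1 q.2 =
      ∑ p ∈ Finset.HasAntidiagonal.antidiagonal n, ∑ q ∈ Finset.HasAntidiagonal.antidiagonal p.2, f q.1 p.1 q.2 := by
  rw [Finset.sum_sigma', Finset.sum_sigma']
  refine Finset.sum_nbij' (fun x => ⟨(x.2.1, x.1.1 + x.2.2), (x.1.1, x.2.2)⟩)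
    (fun x => ⟨(x.2.1, x.1.1 + x.2.2), (x.1.1, x.2.2)⟩) ?_ ?_ ?_ ?_ ?_
  all_goals
    rintro ⟨⟨a, b⟩, c, d⟩ h
    simp only [Finset.mem_sigma, Finset.HasAntidiagonal.mem_antidiagonal] at h
    obtain ⟨h1, rfl⟩ := h
    simp <;> omega

/-- A special case of Abel's binomial theorem. -/
theorem sum_treeCoeff_mul_pow {n : ℕ} (hn : n ≠ 0) :
    ∑ p ∈ Finset.HasAntidiagonal.antidiagonal n, treeCoeff p.1 * ((p.2 : ℚ) ^ p.2 / p.2.factorial) =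
      n * treeCoeff n := by
  calc
    _ = ∑ p ∈ Finset.HasAntidiagonal.antidiagonal n, ∑ q ∈ Finset.HasAntidiagonal.antidiagonal p.2,
          treeCoeff p.1 * ((n : ℚ) ^ q.1 / q.1.factorial *
            ((-(p.1 : ℚ)) ^ q.2 / q.2.factorial)) := by
      refine Finset.sum_congr rfl fun p hp => ?_
      rw [← Finset.mul_sum, ← add_pow_div_factorial, ← Finset.HasAntidiagonal.mem_antidiagonal.1 hp]
      push_cast
      ring
    _ = ∑ p ∈ Finset.HasAntidiagonal.antidiagonal n, (n : ℚ) ^ p.1 / p.1.factorial *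
          if p.2 = 1 then 1 else 0 := by
      rw [sum_antidiagonal_assoc fun j i l => treeCoeff j * ((n : ℚ) ^ i / i.factorial *
            ((-(j : ℚ)) ^ l / l.factorial))]
      refine Finset.sum_congr rfl fun p _ => ?_
      rw [← sum_treeCoeff_mul_neg_pow, Finset.mul_sum]
      exact Finset.sum_congr rfl fun q _ => by ring
    _ = n * treeCoeff n := by
      obtain ⟨m, rfl⟩ := Nat.exists_eq_succ_of_ne_zero hn
      rw [Finset.sum_eq_single (m, 1)]
      · have h : (m.factorial : ℚ) ≠ 0 := by exact_mod_cast m.factorial_ne_zero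
        have h' : ((m : ℚ) + 1) ≠ 0 := by positivity
        simp [treeCoeff, Nat.factorial_succ]
        field_simp
      · rintro ⟨a, b⟩ hp hne
        have hab := Finset.HasAntidiagonal.mem_antidiagonal.1 hp
        have : b ≠ 1 := by
          rintro rfl
          exact hne (by simp at hab; simp [hab])
        simp [this]
      · simp

theorem treeCoeff_recurrence (n : ℕ) :
    ((n : ℚ) - 1) * treeCoeff n =
      ∑ p ∈ Finset.HasAntidiagonal.antidiagonal n, (p.1 : ℚ) * treeCoeff p.1 * treeCoeff p.2 := by
  rcases n with _ | n
  · simp [treeCoeff]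
  have h := sum_treeCoeff_mul_pow n.succ_ne_zero
  rw [Finset.Nat.sum_antidiagonal_succ'] at h
  rw [← Finset.Nat.sum_antidiagonal_swap, Finset.Nat.sum_antidiagonal_succ', sub_mul, ← h]
  simp only [Prod.fst_swap, Prod.snd_swap, mul_treeCoeff (Nat.succ_ne_zero _)]
  simp [mul_comm]

theorem RootedTree.weight_eq_treeCoeff (n : ℕ) : weight n = treeCoeff n := by
  induction n using Nat.strong_induction_on with
  | _ n ih =>
    rcases n with _ | _ | n
    · simp [weight_zero, treeCoeff]
    · simp [weight_one, treeCoeff]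
    have hne : ((n + 1 + 1 : ℕ) : ℚ) - 1 ≠ 0 := by
      push_cast
      rw [add_sub_cancel_right]
      positivity
    refine mul_left_cancel₀ hne ?_
    rw [weight_recurrence, treeCoeff_recurrence]
    refine Finset.sum_congr rfl fun p hp => ?_
    have hp := Finset.HasAntidiagonal.mem_antidiagonal.1 hp
    rcases Nat.eq_zero_or_pos p.1 with h1 | h1
    · simp [h1]
    rcases Nat.eq_zero_or_pos p.2 with h2 | h2
    · simp [h2, weight_zero, treeCoeff]
    rw [ih p.1 (by omega), ih p.2 (by omega)]

/-- `∑_{v(T)=n} 1/α(T) = n^{n−1}/n!`. -/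
theorem sum_inv_alpha (n : ℕ) (hn : 1 ≤ n) :
    ∑ᶠ T : {T : RootedTree // T.v = n}, ((T.1.alpha : ℚ))⁻¹ =
      (n : ℚ) ^ (n - 1) / (n.factorial : ℚ) := by
  change ∑ᶠ T : {T : RootedTree | T.v = n}, ((T.1.alpha : ℚ))⁻¹ = _
  rw [finsum_set_coe_eq_finsum_mem {T : RootedTree | T.v = n}
      (f := fun T : RootedTree => (T.alpha : ℚ)⁻¹),
    finsum_mem_eq_finite_toFinset_sum _ (RootedTree.finite_setOf_v_eq n)]
  exact (RootedTree.weight_eq_treeCoeff n).trans (if_neg (by omega))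

end ZhaoForest
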